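/- arXiv:2312.05977 — 4 statements merged into one kernel-verified Lean document; each statement's English description precedes it below -/
import Mathlib

section
/- Let (S, 𝒜, P) be a probability space, let ψ : [0,1] → [0,1] be continuous and nondecreasing with ψ(0) = 0 and ψ(1) = 1, let M > 0, and let v_n, v : S → ℝ be measurable functions with |v_n| ≤ M for all n and |v| ≤ M. If the cumulative distribution functions F_{v_n}(t) = P(v_n ≤ t) converge to F_v(t) = P(v ≤ t) at every continuity point t of F_v (convergence in distribution), then I_{ψ,P}(v_n) → I_{ψ,P}(v) as n → ∞. -/
open MeasureTheory

/-- The distorted (Choquet) functional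
`I_{ψ,P}(v) = ∫_{-∞}^0 (ψ(P(v > t)) − 1) dt + ∫_0^∞ ψ(P(v > t)) dt`. -/
noncomputable def distorted {S : Type*} [MeasurableSpace S] (P : Measure S)
    (ψ : ℝ → ℝ) (v : S → ℝ) : ℝ :=
  (∫ t in Set.Iio (0 : ℝ), (ψ ((P {s | t < v s}).toReal) - 1)) +
    ∫ t in Set.Ioi (0 : ℝ), ψ ((P {s | t < v s}).toReal)

theorem toReal_measure_mem_Icc {S : Type*} [MeasurableSpace S] (P : Measure S)
    [IsProbabilityMeasure P] (A : Set S) : (P A).toReal ∈ Set.Icc (0 : ℝ) 1 :=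
  ⟨ENNReal.toReal_nonneg, measureReal_le_one⟩

theorem toReal_measure_lt_eq_one_sub {S : Type*} [MeasurableSpace S] (P : Measure S)
    [IsProbabilityMeasure P] {v : S → ℝ} (hv : Measurable v) (t : ℝ) :
    (P {s | t < v s}).toReal = 1 - (P {s | v s ≤ t}).toReal := by
  have h : {s | t < v s} = {s | v s ≤ t}ᶜ := by ext s; simp
  rw [h]
  exact probReal_compl_eq_one_sub (measurableSet_le hv measurable_const)

theorem antitone_distorted_survival {S : Type*} [MeasurableSpace S] (P : Measure S)
    [IsProbabilityMeasure P] {ψ : ℝ → ℝ} (hψ : MonotoneOn ψ (Set.Icc 0 1)) (v : S → ℝ) :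
    Antitone fun t => ψ (P {s | t < v s}).toReal := fun _ _ hab =>
  hψ (toReal_measure_mem_Icc P _) (toReal_measure_mem_Icc P _)
    (measureReal_mono fun _ hs => lt_of_le_of_lt hab hs)

theorem toReal_measure_lt_of_lt_neg {S : Type*} [MeasurableSpace S] (P : Measure S)
    [IsProbabilityMeasure P] {v : S → ℝ} {M t : ℝ} (hv : ∀ s, |v s| ≤ M) (ht : t < -M) :
    (P {s | t < v s}).toReal = 1 := by
  have h : {s | t < v s} = Set.univ :=
    Set.eq_univ_of_forall fun s => lt_of_lt_of_le ht (abs_le.1 (hv s)).1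
  simp [h]

theorem toReal_measure_lt_of_lt {S : Type*} [MeasurableSpace S] (P : Measure S)
    {v : S → ℝ} {M t : ℝ} (hv : ∀ s, |v s| ≤ M) (ht : M < t) :
    (P {s | t < v s}).toReal = 0 := by
  have h : {s | t < v s} = ∅ :=
    Set.eq_empty_of_forall_notMem fun s hs => lt_asymm hs ((abs_le.1 (hv s)).2.trans_lt ht)
  simp [h]

/-- Convergence of distribution functions at continuity points of the limit gives almost
everywhere convergence of the distorted survival functions. -/
theorem ae_tendsto_distorted_survival {S : Type*} [MeasurableSpace S] (P : Measure S)
    [IsProbabilityMeasure P] {ψ : ℝ → ℝ} (hψ : ContinuousOn ψ (Set.Icc 0 1))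
    {vn : ℕ → S → ℝ} {v : S → ℝ} (hvn : ∀ n, Measurable (vn n)) (hv : Measurable v)
    (hconv : ∀ t : ℝ, ContinuousAt (fun x => (P {s | v s ≤ x}).toReal) t →
      Filter.Tendsto (fun n => (P {s | vn n s ≤ t}).toReal) Filter.atTop
        (nhds ((P {s | v s ≤ t}).toReal))) :
    ∀ᵐ t : ℝ, Filter.Tendsto (fun n => ψ (P {s | t < vn n s}).toReal) Filter.atTop
      (nhds (ψ (P {s | t < v s}).toReal)) := by
  have hmono : Monotone fun x => (P {s | v s ≤ x}).toReal := fun _ _ hab =>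
    measureReal_mono fun _ hs => le_trans hs hab
  filter_upwards [hmono.countable_not_continuousAt.ae_notMem volume] with t ht
  have hlim : Filter.Tendsto (fun n => (P {s | t < vn n s}).toReal) Filter.atTop
      (nhds (P {s | t < v s}).toReal) := by
    simp only [toReal_measure_lt_eq_one_sub P (hvn _), toReal_measure_lt_eq_one_sub P hv]
    exact (hconv t (not_not.1 ht)).const_sub 1
  exact (hψ _ (toReal_measure_mem_Icc P _)).tendsto.comp
    (tendsto_nhdsWithin_iff.2 ⟨hlim, .of_forall fun n => toReal_measure_mem_Icc P _⟩)

/-- For a continuous nondecreasing distortion `ψ`, the distorted functional is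
continuous with respect to convergence in distribution of uniformly bounded
sequences of random variables. -/
theorem distorted_tendsto_of_tendstoInDistribution {S : Type*} [MeasurableSpace S]
    (P : Measure S) [IsProbabilityMeasure P]
    (ψ : ℝ → ℝ) (hψmono : MonotoneOn ψ (Set.Icc 0 1))
    (hψcont : ContinuousOn ψ (Set.Icc 0 1))
    (hψmap : Set.MapsTo ψ (Set.Icc 0 1) (Set.Icc 0 1))
    (hψ0 : ψ 0 = 0) (hψ1 : ψ 1 = 1)
    (M : ℝ) (hM : 0 < M)
    (vn : ℕ → S → ℝ) (v : S → ℝ)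
    (hvn : ∀ n, Measurable (vn n)) (hv : Measurable v)
    (hvnb : ∀ n s, |vn n s| ≤ M) (hvb : ∀ s, |v s| ≤ M)
    (hconv : ∀ t : ℝ, ContinuousAt (fun x => (P {s | v s ≤ x}).toReal) t →
      Filter.Tendsto (fun n => (P {s | vn n s ≤ t}).toReal) Filter.atTop
        (nhds ((P {s | v s ≤ t}).toReal))) :
    Filter.Tendsto (fun n => distorted P ψ (vn n)) Filter.atTop
      (nhds (distorted P ψ v)) := by
  have hlim := ae_tendsto_distorted_survival P hψcont hvn hv hconv
  have hmeas n : Measurable fun t => ψ (P {s | t < vn n s}).toReal :=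
    (antitone_distorted_survival P hψmono (vn n)).measurable
  have hmem n t : ψ (P {s | t < vn n s}).toReal ∈ Set.Icc (0 : ℝ) 1 :=
    hψmap (toReal_measure_mem_Icc P _)
  have hbound : Integrable ((Set.Icc (-M) M).indicator fun _ => (1 : ℝ)) :=
    (integrable_indicator_iff measurableSet_Icc).2 (integrableOn_const (by simp))
  refine Filter.Tendsto.add ?_ ?_
  · refine tendsto_integral_of_dominated_convergence _
      (fun n => ((hmeas n).sub_const 1).aestronglyMeasurable) hbound.restrict (fun n => ?_)
      (ae_restrict_of_ae (hlim.mono fun t ht => ht.sub_const 1))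
    filter_upwards [ae_restrict_mem measurableSet_Iio] with t ht
    rw [Set.mem_Iio] at ht
    by_cases h : -M ≤ t
    · rw [Set.indicator_of_mem (Set.mem_Icc.2 ⟨h, by linarith⟩), Real.norm_eq_abs, abs_le]
      constructor <;> linarith [(hmem n t).1, (hmem n t).2]
    · rw [toReal_measure_lt_of_lt_neg P (hvnb n) (not_le.1 h), hψ1, sub_self, norm_zero]
      exact Set.indicator_nonneg (fun _ _ => zero_le_one) t
  · refine tendsto_integral_of_dominated_convergence _
      (fun n => (hmeas n).aestronglyMeasurable) hbound.restrict (fun n => ?_)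
      (ae_restrict_of_ae hlim)
    filter_upwards [ae_restrict_mem measurableSet_Ioi] with t ht
    rw [Set.mem_Ioi] at ht
    by_cases h : t ≤ M
    · rw [Set.indicator_of_mem (Set.mem_Icc.2 ⟨by linarith, h⟩), Real.norm_eq_abs, abs_le]
      constructor <;> linarith [(hmem n t).1, (hmem n t).2]
    · rw [toReal_measure_lt_of_lt P (hvnb n) (not_le.1 h), hψ0, norm_zero]
      exact Set.indicator_nonneg (fun _ _ => zero_le_one) t
end

section
/- Let (S, 𝒜, P) be a probability space, let λ ∈ (0,1], and let v : S → ℝ be a bounded measurable function. Define Value-at-Risk VaR_γ(v) := inf { t ∈ ℝ : P(−v ≤ t) ≥ 1 − γ } for γ ∈ (0,1), Expected Shortfall ES_λ(v) := (1/λ) ∫_0^λ VaR_γ(v) dγ, and the probability weighting function ψ(γ) := max(γ − (1 − λ), 0)/λ for γ ∈ [0,1]. Then I_{ψ,P}(v) = −ES_λ(v); that is, Expected Shortfall corresponds to (minus) the distorted functional with this ψ. -/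
open MeasureTheory

/-- Value-at-Risk: `VaR_γ(v) = inf { t | P(−v ≤ t) ≥ 1 − γ }`. -/
noncomputable def VaR {S : Type*} [MeasurableSpace S] (P : Measure S)
    (v : S → ℝ) (γ : ℝ) : ℝ :=
  sInf {t : ℝ | 1 - γ ≤ (P {s | -v s ≤ t}).toReal}

/-- Expected Shortfall: `ES_λ(v) = (1/λ) ∫_0^λ VaR_γ(v) dγ`. -/
noncomputable def ES {S : Type*} [MeasurableSpace S] (P : Measure S)
    (v : S → ℝ) (lam : ℝ) : ℝ :=
  (1 / lam) * ∫ γ in (0 : ℝ)..lam, VaR P v γ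

namespace ExpectedShortfall

variable {S : Type*} [MeasurableSpace S] {P : Measure S} {v : S → ℝ} {K γ t lam : ℝ}

lemma neg_le_of_le_measure (hK : ∀ s, |v s| < K) (hγ : γ < 1)
    (h : 1 - γ ≤ (P {s | -v s ≤ t}).toReal) : -K ≤ t := by
  by_contra! ht
  have : {s | -v s ≤ t} = ∅ := by
    ext s
    have := (abs_lt.1 (hK s)).2
    simp only [Set.mem_ofPred_eq, Set.mem_empty_iff_false, iff_false]
    linarith
  rw [this] at h
  simp at h
  linarith

lemma measure_lt_eq_zero (hK : ∀ s, |v s| < K) (ht : t ≤ -K) : (P {s | v s < t}).toReal = 0 := by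
  have : {s | v s < t} = ∅ := by
    ext s
    have := (abs_lt.1 (hK s)).1
    simp only [Set.mem_ofPred_eq, Set.mem_empty_iff_false, iff_false]
    linarith
  simp [this]

variable [IsProbabilityMeasure P]

lemma measure_neg_le_eq_cdf (hv : Measurable v) (t : ℝ) :
    (P {s | -v s ≤ t}).toReal = ProbabilityTheory.cdf (P.map (fun s => -v s)) t := by
  have : IsProbabilityMeasure (P.map (fun s => -v s)) :=
    Measure.isProbabilityMeasure_map hv.neg.aemeasurable
  have hneg : Measurable fun s => -v s := hv.neg
  rw [ProbabilityTheory.cdf_eq_real, Measure.real, Measure.map_apply hneg measurableSet_Iic]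
  rfl

lemma measure_neg_le_eq_one (hK : ∀ s, |v s| < K) (ht : K ≤ t) :
    (P {s | -v s ≤ t}).toReal = 1 := by
  have : {s | -v s ≤ t} = Set.univ := by
    ext s
    have := (abs_lt.1 (hK s)).1
    simp only [Set.mem_ofPred_eq, Set.mem_univ, iff_true]
    linarith
  simp [this]

lemma VaR_le_iff (hv : Measurable v) (hK : ∀ s, |v s| < K) (hγ : γ ∈ Set.Ioo (0 : ℝ) 1) :
    VaR P v γ ≤ t ↔ 1 - γ ≤ (P {s | -v s ≤ t}).toReal := by
  have hbdd : BddBelow {t : ℝ | 1 - γ ≤ (P {s | -v s ≤ t}).toReal} :=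
    ⟨-K, fun u hu => neg_le_of_le_measure hK hγ.2 hu⟩
  have hne : {t : ℝ | 1 - γ ≤ (P {s | -v s ≤ t}).toReal}.Nonempty :=
    ⟨K, by rw [Set.mem_ofPred_eq, measure_neg_le_eq_one hK le_rfl]; linarith [hγ.1]⟩
  refine ⟨fun h => ?_, fun h => csInf_le hbdd h⟩
  have hright := ((ProbabilityTheory.cdf (P.map (fun s => -v s))).right_continuous t).mono_left
    (nhdsWithin_mono t Set.Ioi_subset_Ici_self)
  rw [measure_neg_le_eq_cdf hv]
  refine ge_of_tendsto hright ?_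
  filter_upwards [self_mem_nhdsWithin] with u hu
  obtain ⟨w, hw, hwu⟩ := exists_lt_of_csInf_lt hne (lt_of_le_of_lt h hu)
  rw [Set.mem_ofPred_eq, measure_neg_le_eq_cdf hv] at hw
  exact hw.trans (ProbabilityTheory.monotone_cdf _ hwu.le)

lemma VaR_mem_Icc (hv : Measurable v) (hK : ∀ s, |v s| < K) (hγ : γ ∈ Set.Ioo (0 : ℝ) 1) :
    VaR P v γ ∈ Set.Icc (-K) K :=
  ⟨neg_le_of_le_measure hK hγ.2 ((VaR_le_iff hv hK hγ).1 le_rfl),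
    (VaR_le_iff hv hK hγ).2 (by rw [measure_neg_le_eq_one hK le_rfl]; linarith [hγ.1])⟩

lemma antitoneOn_VaR (hv : Measurable v) (hK : ∀ s, |v s| < K) :
    AntitoneOn (VaR P v) (Set.Ioo 0 1) := by
  intro a ha b hb hab
  rw [VaR_le_iff hv hK hb]
  linarith [(VaR_le_iff (P := P) hv hK ha).1 le_rfl]

lemma integrableOn_VaR (hv : Measurable v) (hK : ∀ s, |v s| < K) :
    IntegrableOn (VaR P v) (Set.Ioo 0 1) := by
  refine IntegrableOn.of_bound (by simp) (aemeasurable_restrict_of_antitoneOn measurableSet_Ioo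
    (antitoneOn_VaR hv hK)).aestronglyMeasurable K ?_
  filter_upwards [ae_restrict_mem measurableSet_Ioo] with γ hγ
  exact abs_le.2 (VaR_mem_Icc hv hK hγ)

lemma measure_neg_le_toReal (hv : Measurable v) (t : ℝ) :
    (P {s | -v s ≤ t}).toReal = 1 - (P {s | v s < -t}).toReal := by
  have h := probReal_compl_eq_one_sub (μ := P) (measurableSet_lt hv measurable_const :
    MeasurableSet {s | v s < -t})
  rw [Measure.real, Measure.real] at h
  rw [← h]
  congr 2
  ext s
  simp [neg_le]

lemma volume_lt_VaR (hv : Measurable v) (hK : ∀ s, |v s| < K) (hlam : lam ∈ Set.Ioc (0 : ℝ) 1)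
    (t : ℝ) :
    (volume.restrict (Set.Ioo 0 lam)).real {γ | t < VaR P v γ} =
      min lam (P {s | v s < -t}).toReal := by
  rw [measureReal_restrict_apply' measurableSet_Ioo]
  have : {γ | t < VaR P v γ} ∩ Set.Ioo 0 lam =
      Set.Ioo 0 (min lam (P {s | v s < -t}).toReal) := by
    ext γ
    simp only [Set.mem_inter_iff, Set.mem_ofPred_eq, Set.mem_Ioo, lt_min_iff]
    have key (h0 : 0 < γ) (h1 : γ < lam) :
        t < VaR P v γ ↔ γ < (P {s | v s < -t}).toReal := by
      rw [← not_le, VaR_le_iff hv hK ⟨h0, h1.trans_le hlam.2⟩, measure_neg_le_toReal hv, not_le]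
      constructor <;> intro h <;> linarith
    constructor
    · rintro ⟨h, h0, h1⟩
      exact ⟨h0, h1, (key h0 h1).1 h⟩
    · rintro ⟨h0, h1, h⟩
      exact ⟨(key h0 h1).2 h, h0, h1⟩
  rw [this, Real.volume_real_Ioo_of_le (le_min hlam.1.le ENNReal.toReal_nonneg), sub_zero]

lemma integral_VaR (hv : Measurable v) (hK : ∀ s, |v s| < K) (hK0 : 0 < K)
    (hlam : lam ∈ Set.Ioc (0 : ℝ) 1) :
    ∫ γ in (0 : ℝ)..lam, VaR P v γ =
      (∫ t in (-K)..K, min lam (P {s | v s < t}).toReal) - K * lam := by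
  have hint : IntegrableOn (VaR P v) (Set.Ioo 0 lam) :=
    (integrableOn_VaR hv hK).mono_set (Set.Ioo_subset_Ioo_right hlam.2)
  have hcake := (hint.add (integrable_const K)).integral_eq_integral_meas_lt (by
    filter_upwards [ae_restrict_mem measurableSet_Ioo] with γ hγ
    have := (VaR_mem_Icc (P := P) hv hK ⟨hγ.1, hγ.2.trans_le hlam.2⟩).1
    simp only [Pi.zero_apply, Pi.add_apply]
    linarith)
  have hset (t : ℝ) : (volume.restrict (Set.Ioo 0 lam)).real
      {γ | t < (VaR P v + fun _ => K : ℝ → ℝ) γ} = min lam (P {s | v s < K - t}).toReal := by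
    rw [show K - t = -(t - K) by ring, ← volume_lt_VaR hv hK hlam]
    congr 1
    ext γ
    simp [sub_lt_iff_lt_add]
  simp_rw [hset] at hcake
  have hsub : ∫ t in Set.Ioi (0 : ℝ), min lam (P {s | v s < K - t}).toReal =
      ∫ t in (0 : ℝ)..(2 * K), min lam (P {s | v s < K - t}).toReal := by
    rw [intervalIntegral.integral_of_le (by linarith)]
    refine (setIntegral_eq_of_subset_of_forall_sdiff_eq_zero measurableSet_Ioi
      Set.Ioc_subset_Ioi_self fun t ht => ?_)
    have : 2 * K < t := by
      by_contra! h
      exact ht.2 ⟨ht.1, h⟩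
    rw [measure_lt_eq_zero hK (by linarith), min_eq_right hlam.1.le]
  rw [hsub, intervalIntegral.integral_comp_sub_left
    (fun t => min lam (P {s | v s < t}).toReal)] at hcake
  simp only [Pi.add_apply] at hcake
  rw [integral_add hint (integrable_const K)] at hcake
  rw [intervalIntegral.integral_of_le hlam.1.le, integral_Ioc_eq_integral_Ioo]
  simp only [integral_const, measureReal_restrict_apply_univ,
    Real.volume_real_Ioo_of_le hlam.1.le, smul_eq_mul, sub_zero] at hcake
  rw [show K - 2 * K = -K by ring] at hcake
  linarith

lemma ae_measure_le_eq_measure_lt (hv : Measurable v) :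
    ∀ᵐ t : ℝ, (P {s | v s ≤ t}).toReal = (P {s | v s < t}).toReal := by
  have hc := Measure.countable_meas_level_set_pos (μ := P) hv
  filter_upwards [hc.ae_notMem volume] with t ht
  have h0 : P {s | v s = t} = 0 := by simpa using ht
  congr 1
  refine le_antisymm ?_ (measure_mono fun s (hs : v s < t) => hs.le)
  calc P {s | v s ≤ t} ≤ P ({s | v s < t} ∪ {s | v s = t}) :=
        measure_mono fun s (hs : v s ≤ t) => lt_or_eq_of_le hs
    _ ≤ P {s | v s < t} + P {s | v s = t} := measure_union_le _ _
    _ = _ := by rw [h0, add_zero]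

lemma distortion_eq (hv : Measurable v) (hlam : 0 < lam) (t : ℝ) :
    max ((P {s | t < v s}).toReal - (1 - lam)) 0 / lam =
      1 - min lam (P {s | v s ≤ t}).toReal / lam := by
  have h := probReal_compl_eq_one_sub (μ := P) (measurableSet_le hv measurable_const :
    MeasurableSet {s | v s ≤ t})
  have hc : {s | v s ≤ t}ᶜ = {s | t < v s} := by ext s; simp
  rw [hc, Measure.real, Measure.real] at h
  rw [h, eq_sub_iff_add_eq, ← add_div, div_eq_one_iff_eq hlam.ne']
  rcases le_total lam (P {s | v s ≤ t}).toReal with h | h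
  · rw [min_eq_left h, max_eq_right (by linarith)]; ring
  · rw [min_eq_right h, max_eq_left (by linarith)]; ring

lemma intervalIntegrable_min (lam a b : ℝ) :
    IntervalIntegrable (fun t => min lam (P {s | v s ≤ t}).toReal) volume a b :=
  Monotone.intervalIntegrable fun _ _ h => min_le_min_left _ <|
    ENNReal.toReal_mono (measure_ne_top _ _) <| measure_mono fun _ hs => le_trans hs h

lemma distorted_eq (hv : Measurable v) (hK : ∀ s, |v s| < K) (hK0 : 0 < K)
    (hlam : lam ∈ Set.Ioc (0 : ℝ) 1) :
    distorted P (fun γ => max (γ - (1 - lam)) 0 / lam) v =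
      K - (∫ t in (-K)..K, min lam (P {s | v s ≤ t}).toReal) / lam := by
  have hneg : ∫ t in Set.Iio (0 : ℝ), (1 - min lam (P {s | v s ≤ t}).toReal / lam - 1) =
      -((∫ t in (-K)..0, min lam (P {s | v s ≤ t}).toReal) / lam) := by
    rw [← intervalIntegral.integral_div, ← intervalIntegral.integral_neg,
      intervalIntegral.integral_of_le (by linarith), ← integral_Iic_eq_integral_Iio]
    simp only [sub_sub_cancel_left]
    refine setIntegral_eq_of_subset_of_forall_sdiff_eq_zero measurableSet_Iic
      Set.Ioc_subset_Iic_self fun t ht => ?_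
    have htK : t ≤ -K := by
      by_contra! h
      exact ht.2 ⟨h, ht.1⟩
    have : {s | v s ≤ t} = ∅ := by
      ext s
      have := (abs_lt.1 (hK s)).1
      simp only [Set.mem_ofPred_eq, Set.mem_empty_iff_false, iff_false]
      linarith
    simp [this, hlam.1.le]
  have hpos : ∫ t in Set.Ioi (0 : ℝ), (1 - min lam (P {s | v s ≤ t}).toReal / lam) =
      K - (∫ t in (0 : ℝ)..K, min lam (P {s | v s ≤ t}).toReal) / lam := by
    have : K - (∫ t in (0 : ℝ)..K, min lam (P {s | v s ≤ t}).toReal) / lam =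
        ∫ t in (0 : ℝ)..K, (1 - min lam (P {s | v s ≤ t}).toReal / lam) := by
      rw [intervalIntegral.integral_sub (by simp) ((intervalIntegrable_min lam 0 K).div_const lam),
        intervalIntegral.integral_div]
      simp
    rw [this, intervalIntegral.integral_of_le hK0.le]
    refine setIntegral_eq_of_subset_of_forall_sdiff_eq_zero measurableSet_Ioi
      Set.Ioc_subset_Ioi_self fun t ht => ?_
    have htK : K < t := by
      by_contra! h
      exact ht.2 ⟨ht.1, h⟩
    have : {s | v s ≤ t} = Set.univ := by
      ext s
      have := (abs_lt.1 (hK s)).2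
      simp only [Set.mem_ofPred_eq, Set.mem_univ, iff_true]
      linarith
    simp [this, hlam.2, hlam.1.ne']
  simp only [distorted, distortion_eq hv hlam.1]
  rw [hneg, hpos, ← intervalIntegral.integral_add_adjacent_intervals
    (intervalIntegrable_min lam (-K) 0) (intervalIntegrable_min lam 0 K)]
  ring

end ExpectedShortfall

/-- Expected Shortfall corresponds to (minus) the distorted functional with the
probability weighting function `ψ(γ) = max(γ − (1 − λ), 0)/λ`. -/
theorem distorted_eq_neg_expectedShortfall {S : Type*} [MeasurableSpace S]
    (P : Measure S) [IsProbabilityMeasure P]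
    (lam : ℝ) (hlam : lam ∈ Set.Ioc (0 : ℝ) 1)
    (v : S → ℝ) (hv : Measurable v) (hvb : ∃ M, ∀ s, |v s| ≤ M) :
    distorted P (fun γ => max (γ - (1 - lam)) 0 / lam) v = -ES P v lam := by
  obtain ⟨M, hM⟩ := hvb
  have hK (s : S) : |v s| < |M| + 1 := by linarith [hM s, le_abs_self M]
  have hK0 : 0 < |M| + 1 := by positivity
  have hae : ∫ t in (-(|M| + 1))..(|M| + 1), min lam (P {s | v s ≤ t}).toReal =
      ∫ t in (-(|M| + 1))..(|M| + 1), min lam (P {s | v s < t}).toReal := by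
    refine intervalIntegral.integral_congr_ae ?_
    filter_upwards [ExpectedShortfall.ae_measure_le_eq_measure_lt (P := P) hv] with t ht _
    rw [ht]
  have hlam0 := hlam.1.ne'
  rw [ExpectedShortfall.distorted_eq hv hK hK0 hlam, hae, ES,
    ExpectedShortfall.integral_VaR hv hK hK0 hlam]
  field_simp
  ring
end

section
/- Let W and S be nonempty sets, Ω = W × S, and let I ⊆ ℝ be an interval with 0 ∈ I. Let ⪰ be a reflexive binary relation on the set of bounded, finite-valued functions f : Ω → I satisfying the certainty dual independence condition A7⁰: for all such f, g and every bounded finite-valued r : Ω → I depending only on the second coordinate s such that, for each w ∈ W, s ↦ f(w,s) and r are comonotonic and s ↦ g(w,s) and r are comonotonic, one has f ⪰ g if and only if α·f + (1−α)·r ⪰ α·g + (1−α)·r for every α ∈ (0,1). Then ⪰ is scale invariant: for all bounded finite-valued I-valued f, g and every λ ≥ 0 such that λ·f and λ·g are I-valued, f ⪰ g if and only if λ·f ⪰ λ·g. -/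
/-- The certainty dual independence axiom A7⁰ implies scale invariance of the
preference: for `I`-valued finite-valued `f, g`, `f ⪰ g` if and only if
`λ·f ⪰ λ·g` for every `λ ≥ 0` such that `λ·f` and `λ·g` are `I`-valued. -/
theorem scale_invariance_of_certainty_dual_independence {W S : Type*}
    [Nonempty W] [Nonempty S]
    (I : Set ℝ) (hIoc : I.OrdConnected) (h0I : (0 : ℝ) ∈ I)
    (pre : (W × S → ℝ) → (W × S → ℝ) → Prop)
    (hrefl : ∀ f : W × S → ℝ, (Set.range f).Finite → (∀ ω, f ω ∈ I) → pre f f)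
    (hA70 : ∀ f g r : W × S → ℝ,
      (Set.range f).Finite → (Set.range g).Finite → (Set.range r).Finite →
      (∀ ω, f ω ∈ I) → (∀ ω, g ω ∈ I) → (∀ ω, r ω ∈ I) →
      (∀ (w w' : W) (s : S), r (w, s) = r (w', s)) →
      (∀ (w : W) (s s' : S), (f (w, s') - f (w, s)) * (r (w, s') - r (w, s)) ≥ 0) →
      (∀ (w : W) (s s' : S), (g (w, s') - g (w, s)) * (r (w, s') - r (w, s)) ≥ 0) →
      ∀ α ∈ Set.Ioo (0 : ℝ) 1,
        (pre f g ↔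
          pre (fun ω => α * f ω + (1 - α) * r ω) (fun ω => α * g ω + (1 - α) * r ω))) :
    ∀ f g : W × S → ℝ, (Set.range f).Finite → (Set.range g).Finite →
      (∀ ω, f ω ∈ I) → (∀ ω, g ω ∈ I) →
      (pre f g ↔
        ∀ lam : ℝ, 0 ≤ lam → (∀ ω, lam * f ω ∈ I) → (∀ ω, lam * g ω ∈ I) →
          pre (fun ω => lam * f ω) (fun ω => lam * g ω)) := by
  have scaled_finite : ∀ (c : ℝ) (f : W × S → ℝ), (Set.range f).Finite →
      (Set.range fun ω => c * f ω).Finite := fun c f hf => by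
    simpa only [← Set.range_comp] using! hf.image (fun x => c * x)
  have shrink : ∀ f g : W × S → ℝ, (Set.range f).Finite → (Set.range g).Finite →
      (∀ ω, f ω ∈ I) → (∀ ω, g ω ∈ I) → ∀ α ∈ Set.Ioo (0 : ℝ) 1,
        (pre f g ↔ pre (fun ω => α * f ω) (fun ω => α * g ω)) := by
    intro f g hf hg hfI hgI α hα
    simpa using hA70 f g (fun _ => 0) hf hg (by simp) hfI hgI (fun _ => h0I)
      (by simp) (by simp) (by simp) α hα
  intro f g hf hg hfI hgI
  refine ⟨fun h lam hlam hlf hlg => ?_, fun h => ?_⟩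
  · rcases hlam.eq_or_lt with rfl | hpos
    · simpa using hrefl (fun _ => 0) (by simp) (fun _ => h0I)
    rcases lt_trichotomy lam 1 with hlt | rfl | hgt
    · exact (shrink f g hf hg hfI hgI lam ⟨hpos, hlt⟩).1 h
    · simpa using h
    · refine (shrink _ _ (scaled_finite lam f hf) (scaled_finite lam g hg) hlf hlg lam⁻¹
        ⟨inv_pos.2 hpos, inv_lt_one_of_one_lt₀ hgt⟩).2 ?_
      simpa [inv_mul_cancel_left₀ hpos.ne'] using h
  · simpa using h 1 zero_le_one (by simpa using hfI) (by simpa using hgI)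
end

section
/- Let W be a nonempty measurable space and S a measurable space, and let (P^w)_{w ∈ W} be a Markov kernel from W to S (each P^w is a probability measure on S and w ↦ P^w(A) is measurable for each measurable A). Let ψ : [0,1] → [0,1] be nondecreasing with ψ(0) = 0 and ψ(1) = 1. Let ṽ : W × S → ℝ be bounded and jointly measurable, and let r : S → ℝ be bounded and measurable such that: (i) for every w ∈ W, the functions s ↦ ṽ(w,s) and r are comonotonic; and (ii) r is unambiguous, i.e., P^w(r > t) = P^{w'}(r > t) for all w, w' ∈ W and t ∈ ℝ; write κ for the common value I_{ψ,P^w}(r). Then: (1) for every w ∈ W, I_{ψ,P^w}(ṽ(w,·) + r) = I_{ψ,P^w}(ṽ(w,·)) + κ; and (2) for every nonempty set 𝒬 of probability measures on W and every function c : 𝒬 → [0,∞], provided w ↦ I_{ψ,P^w}(ṽ(w,·)) is measurable, inf_{Q ∈ 𝒬} { ∫_W I_{ψ,P^w}(ṽ(w,·) + r) dQ(w) + c(Q) } = inf_{Q ∈ 𝒬} { ∫_W I_{ψ,P^w}(ṽ(w,·)) dQ(w) + c(Q) } + κ. -/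
open MeasureTheory

/-- The upper quantile at level `α` of a decumulative function `G`. -/
noncomputable def upperQuantile (G : ℝ → ℝ) (α : ℝ) : ℝ := sSup {t | α < G t}

/-- Antitone functions that equal `1` to the left of `-M` and `0` from `M` on. -/
structure IsDecumulative (G : ℝ → ℝ) (M : ℝ) : Prop where
  antitone : Antitone G
  eq_one : ∀ t < -M, G t = 1
  eq_zero : ∀ t, M ≤ t → G t = 0

namespace IsDecumulative

variable {G : ℝ → ℝ} {M α : ℝ}

lemma bound_nonneg (h : IsDecumulative G M) : 0 ≤ M := by
  by_contra! hM
  linarith [h.eq_one M (by linarith), h.eq_zero M le_rfl]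

lemma nonneg (h : IsDecumulative G M) (t : ℝ) : 0 ≤ G t := by
  rw [← h.eq_zero (max t M) (le_max_right _ _)]
  exact h.antitone (le_max_left _ _)

lemma le_one (h : IsDecumulative G M) (t : ℝ) : G t ≤ 1 := by
  rw [← h.eq_one (min t (-M - 1)) ((min_le_right _ _).trans_lt (by linarith))]
  exact h.antitone (min_le_left _ _)

lemma setOf_nonempty (h : IsDecumulative G M) (hα : α < 1) : {t | α < G t}.Nonempty :=
  ⟨-M - 1, by simpa [h.eq_one (-M - 1) (by linarith)] using hα⟩

lemma setOf_bddAbove (h : IsDecumulative G M) (hα : 0 ≤ α) : BddAbove {t | α < G t} := by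
  refine ⟨M, fun t ht => ?_⟩
  by_contra! hlt
  have ht' : α < G t := ht
  rw [h.eq_zero t hlt.le] at ht'
  linarith

lemma lt_of_lt_upperQuantile (h : IsDecumulative G M) (hα : α < 1) {t : ℝ}
    (ht : t < upperQuantile G α) : α < G t := by
  obtain ⟨u, hu, htu⟩ := exists_lt_of_lt_csSup (h.setOf_nonempty hα) ht
  exact lt_of_lt_of_le hu (h.antitone htu.le)

lemma le_upperQuantile (h : IsDecumulative G M) (hα : 0 ≤ α) {t : ℝ} (ht : α < G t) :
    t ≤ upperQuantile G α :=
  le_csSup (h.setOf_bddAbove hα) ht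

lemma upperQuantile_le (h : IsDecumulative G M) (hα : α ∈ Set.Ioo (0 : ℝ) 1) :
    upperQuantile G α ≤ M := by
  by_contra! hlt
  have := h.lt_of_lt_upperQuantile hα.2 hlt
  rw [h.eq_zero M le_rfl] at this
  linarith [hα.1]

lemma neg_le_upperQuantile (h : IsDecumulative G M) (hα : α ∈ Set.Ioo (0 : ℝ) 1) :
    -M ≤ upperQuantile G α :=
  le_of_forall_lt fun t ht => by
    obtain ⟨u, htu, hu⟩ := exists_between ht
    exact htu.trans_le (h.le_upperQuantile hα.1.le (by rw [h.eq_one u hu]; exact hα.2))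

lemma antitoneOn_upperQuantile (h : IsDecumulative G M) :
    AntitoneOn (upperQuantile G) (Set.Ioo 0 1) := fun _ ha _ hb hab =>
  csSup_le_csSup (h.setOf_bddAbove ha.1.le) (h.setOf_nonempty hb.2) fun _ ht => hab.trans_lt ht

lemma abs_upperQuantile_le (h : IsDecumulative G M) (hα : α ∈ Set.Ioo (0 : ℝ) 1) :
    |upperQuantile G α| ≤ M :=
  abs_le.2 ⟨h.neg_le_upperQuantile hα, h.upperQuantile_le hα⟩

lemma integrableOn_upperQuantile (h : IsDecumulative G M) :
    IntegrableOn (upperQuantile G) (Set.Ioo 0 1) := by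
  refine Integrable.of_bound
    (aemeasurable_restrict_of_antitoneOn measurableSet_Ioo
      h.antitoneOn_upperQuantile).aestronglyMeasurable M ?_
  exact (ae_restrict_iff' measurableSet_Ioo).2 (.of_forall fun α hα => h.abs_upperQuantile_le hα)

lemma measureReal_setOf_lt (h : IsDecumulative G M) (hα : α ∈ Set.Ioo (0 : ℝ) 1) :
    (volume.restrict (Set.Ioc (-M) M)).real {t | α < G t} = upperQuantile G α + M := by
  have hq := h.neg_le_upperQuantile hα
  have hlower : Set.Ioo (-M) (upperQuantile G α) ⊆ {t | α < G t} ∩ Set.Ioc (-M) M :=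
    fun t ht => ⟨h.lt_of_lt_upperQuantile hα.2 ht.2, ht.1,
      ht.2.le.trans (h.upperQuantile_le hα)⟩
  have hupper : {t | α < G t} ∩ Set.Ioc (-M) M ⊆ Set.Ioc (-M) (upperQuantile G α) :=
    fun t ht => ⟨ht.2.1, h.le_upperQuantile hα.1.le ht.1⟩
  have hle := measureReal_mono (μ := volume) hupper measure_Ioc_lt_top.ne
  have hge := measureReal_mono (μ := volume) hlower (measure_ne_top_of_subset hupper measure_Ioc_lt_top.ne)
  rw [measureReal_restrict_apply' measurableSet_Ioc]
  rw [Real.volume_real_Ioc_of_le hq] at hle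
  rw [Real.volume_real_Ioo_of_le hq] at hge
  linarith

lemma integral_Ioc_eq (h : IsDecumulative G M) :
    ∫ t in Set.Ioc (-M) M, G t = (∫ α in Set.Ioo (0 : ℝ) 1, upperQuantile G α) + M := by
  have hint : IntegrableOn G (Set.Ioc (-M) M) :=
    (h.antitone.intervalIntegrable (μ := volume) (a := -M) (b := M)).1
  rw [Integrable.integral_eq_integral_meas_lt hint (.of_forall h.nonneg),
    setIntegral_eq_of_subset_of_forall_sdiff_eq_zero measurableSet_Ioi
      (Set.Ioo_subset_Ioi_self : Set.Ioo (0 : ℝ) 1 ⊆ Set.Ioi 0),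
    setIntegral_congr_fun measurableSet_Ioo fun α hα => h.measureReal_setOf_lt hα,
    integral_add h.integrableOn_upperQuantile (integrable_const M)]
  · simp
  · intro α hα
    have hα1 : 1 ≤ α := by
      by_contra! hlt
      exact hα.2 ⟨hα.1, hlt⟩
    have : {t | α < G t} = ∅ :=
      Set.eq_empty_of_forall_notMem fun t ht => absurd (h.le_one t) (not_le.2 (hα1.trans_lt ht))
    simp [this]

/-- The asymmetric integral of a decumulative function is the integral of its quantiles. -/
lemma integral_add_integral_eq (h : IsDecumulative G M) :
    (∫ t in Set.Iio (0 : ℝ), (G t - 1)) + ∫ t in Set.Ioi (0 : ℝ), G t =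
      ∫ α in Set.Ioo (0 : ℝ) 1, upperQuantile G α := by
  have hM := h.bound_nonneg
  have hint (a b : ℝ) : IntervalIntegrable G volume a b := h.antitone.intervalIntegrable
  have hpos : ∫ t in Set.Ioi (0 : ℝ), G t = ∫ t in (0 : ℝ)..M, G t := by
    rw [intervalIntegral.integral_of_le hM]
    refine setIntegral_eq_of_subset_of_forall_sdiff_eq_zero measurableSet_Ioi
      Set.Ioc_subset_Ioi_self fun t ht => h.eq_zero t ?_
    by_contra! hlt
    exact ht.2 ⟨ht.1, hlt.le⟩
  have hneg : ∫ t in Set.Iio (0 : ℝ), (G t - 1) = (∫ t in (-M)..0, G t) - M := by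
    have : ∫ t in Set.Iio (0 : ℝ), (G t - 1) = ∫ t in (-M)..0, (G t - 1) := by
      rw [intervalIntegral.integral_of_le (by linarith), ← integral_Ico_eq_integral_Ioc]
      refine setIntegral_eq_of_subset_of_forall_sdiff_eq_zero measurableSet_Iio
        Set.Ico_subset_Iio_self fun t ht => sub_eq_zero.2 (h.eq_one t ?_)
      by_contra! hlt
      exact ht.2 ⟨hlt, ht.1⟩
    rw [this, intervalIntegral.integral_sub (hint _ _) intervalIntegrable_const]
    simp
  have hsum := intervalIntegral.integral_add_adjacent_intervals (hint (-M) 0) (hint 0 M)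
  rw [intervalIntegral.integral_of_le (by linarith : -M ≤ M), h.integral_Ioc_eq] at hsum
  rw [hpos, hneg]
  linarith

end IsDecumulative

section SetFunction

variable {S : Type*} {φ : Set S → ℝ}

lemma isDecumulative_setFunction (hφ : Monotone φ) (hφ0 : φ ∅ = 0) (hφ1 : φ Set.univ = 1)
    {v : S → ℝ} {M : ℝ} (hv : ∀ s, |v s| ≤ M) :
    IsDecumulative (fun t => φ {s | t < v s}) M where
  antitone _ _ hab := hφ fun _ hs => hab.trans_lt hs
  eq_one t ht := by
    have : {s | t < v s} = Set.univ :=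
      Set.eq_univ_of_forall fun s => ht.trans_le (abs_le.1 (hv s)).1
    simp only [this, hφ1]
  eq_zero t ht := by
    have : {s | t < v s} = ∅ :=
      Set.eq_empty_of_forall_notMem fun s hs =>
        absurd ((abs_le.1 (hv s)).2.trans ht) (not_le.2 hs)
    simp only [this, hφ0]

lemma superlevel_subset_or_subset {f g : S → ℝ}
    (hfg : ∀ s s', (f s' - f s) * (g s' - g s) ≥ 0) (a b : ℝ) :
    {s | a < f s} ⊆ {s | b < g s} ∨ {s | b < g s} ⊆ {s | a < f s} := by
  by_contra! hcon
  obtain ⟨⟨x, hx, hx'⟩, ⟨y, hy, hy'⟩⟩ := And.imp Set.not_subset.1 Set.not_subset.1 hcon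
  simp only [Set.mem_ofPred_eq, not_lt] at hx hx' hy hy'
  exact absurd (hfg x y)
    (not_le.2 (mul_neg_of_neg_of_pos (by linarith) (by linarith)))

/-- Quantiles with respect to a monotone set function are comonotonically additive. -/
lemma upperQuantile_add_of_comonotonic (hφ : Monotone φ) (hφ0 : φ ∅ = 0)
    (hφ1 : φ Set.univ = 1) {f g : S → ℝ} {M N : ℝ} (hf : ∀ s, |f s| ≤ M) (hg : ∀ s, |g s| ≤ N)
    (hfg : ∀ s s', (f s' - f s) * (g s' - g s) ≥ 0) {α : ℝ} (hα : α ∈ Set.Ioo (0 : ℝ) 1) :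
    upperQuantile (fun t => φ {s | t < f s + g s}) α =
      upperQuantile (fun t => φ {s | t < f s}) α +
        upperQuantile (fun t => φ {s | t < g s}) α := by
  have hF := isDecumulative_setFunction hφ hφ0 hφ1 hf
  have hG := isDecumulative_setFunction hφ hφ0 hφ1 hg
  have hH := isDecumulative_setFunction hφ hφ0 hφ1 (v := fun s => f s + g s)
    fun s => (abs_add_le _ _).trans (add_le_add (hf s) (hg s))
  apply le_antisymm
  · refine le_of_forall_pos_lt_add fun ε hε => ?_
    set a := upperQuantile (fun t => φ {s | t < f s}) α + ε / 3 with ha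
    set b := upperQuantile (fun t => φ {s | t < g s}) α + ε / 3 with hb
    have hfa : φ {s | a < f s} ≤ α := by
      by_contra! hlt
      linarith [hF.le_upperQuantile hα.1.le hlt]
    have hgb : φ {s | b < g s} ≤ α := by
      by_contra! hlt
      linarith [hG.le_upperQuantile hα.1.le hlt]
    have hunion : {s | a + b < f s + g s} ⊆ {s | a < f s} ∪ {s | b < g s} := fun s hs => by
      by_contra! hcon
      simp only [Set.mem_union, Set.mem_ofPred_eq, not_or, not_lt] at hcon hs
      linarith
    have hab : φ {s | a + b < f s + g s} ≤ α := by
      rcases superlevel_subset_or_subset hfg a b with hsub | hsub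
      · exact (hφ (hunion.trans (Set.union_subset hsub subset_rfl))).trans hgb
      · exact (hφ (hunion.trans (Set.union_subset subset_rfl hsub))).trans hfa
    have : upperQuantile (fun t => φ {s | t < f s + g s}) α ≤ a + b := by
      by_contra! hlt
      exact absurd (hH.lt_of_lt_upperQuantile hα.2 hlt) (not_lt.2 hab)
    linarith
  · refine le_of_forall_pos_le_add fun ε hε => ?_
    set a := upperQuantile (fun t => φ {s | t < f s}) α - ε / 2 with ha
    set b := upperQuantile (fun t => φ {s | t < g s}) α - ε / 2 with hb
    have hfa : α < φ {s | a < f s} := hF.lt_of_lt_upperQuantile hα.2 (by linarith)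
    have hgb : α < φ {s | b < g s} := hG.lt_of_lt_upperQuantile hα.2 (by linarith)
    have hinter : {s | a < f s} ∩ {s | b < g s} ⊆ {s | a + b < f s + g s} :=
      fun s hs => by
        have hs1 : a < f s := hs.1
        have hs2 : b < g s := hs.2
        exact add_lt_add hs1 hs2
    have hab : α < φ {s | a + b < f s + g s} := by
      rcases superlevel_subset_or_subset hfg a b with hsub | hsub
      · exact hfa.trans_le (hφ ((Set.subset_inter subset_rfl hsub).trans hinter))
      · exact hgb.trans_le (hφ ((Set.subset_inter hsub subset_rfl).trans hinter))
    linarith [hH.le_upperQuantile hα.1.le hab]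

end SetFunction

section Distorted

variable {S : Type*} [MeasurableSpace S] {P : Measure S} [IsProbabilityMeasure P] {ψ : ℝ → ℝ}

lemma monotone_distortion (hψ : MonotoneOn ψ (Set.Icc 0 1)) :
    Monotone fun A : Set S => ψ (P A).toReal := fun _ _ hAB =>
  hψ ⟨measureReal_nonneg, measureReal_le_one⟩ ⟨measureReal_nonneg, measureReal_le_one⟩
    (measureReal_mono hAB)

lemma isDecumulative_distortion (hψ : MonotoneOn ψ (Set.Icc 0 1)) (hψ0 : ψ 0 = 0)
    (hψ1 : ψ 1 = 1) {v : S → ℝ} {M : ℝ} (hv : ∀ s, |v s| ≤ M) :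
    IsDecumulative (fun t => ψ (P {s | t < v s}).toReal) M :=
  isDecumulative_setFunction (φ := fun A => ψ (P A).toReal) (monotone_distortion hψ)
    (by simp [hψ0]) (by simp [hψ1]) hv

lemma abs_distorted_le (hψ : MonotoneOn ψ (Set.Icc 0 1)) (hψ0 : ψ 0 = 0)
    (hψ1 : ψ 1 = 1) {v : S → ℝ} {M : ℝ} (hv : ∀ s, |v s| ≤ M) : |distorted P ψ v| ≤ M := by
  have h := isDecumulative_distortion (P := P) hψ hψ0 hψ1 hv
  rw [distorted, h.integral_add_integral_eq]
  simpa using norm_setIntegral_le_of_norm_le_const (μ := volume) (s := Set.Ioo (0 : ℝ) 1)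
    (f := upperQuantile fun t => ψ (P {s | t < v s}).toReal) measure_Ioo_lt_top
    fun α hα => h.abs_upperQuantile_le hα

/-- The distorted functional is comonotonically additive on bounded functions. -/
lemma distorted_add_of_comonotonic (hψ : MonotoneOn ψ (Set.Icc 0 1)) (hψ0 : ψ 0 = 0)
    (hψ1 : ψ 1 = 1) {f g : S → ℝ} {M N : ℝ} (hf : ∀ s, |f s| ≤ M) (hg : ∀ s, |g s| ≤ N)
    (hfg : ∀ s s', (f s' - f s) * (g s' - g s) ≥ 0) :
    distorted P ψ (fun s => f s + g s) = distorted P ψ f + distorted P ψ g := by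
  have hF := isDecumulative_distortion (P := P) hψ hψ0 hψ1 hf
  have hG := isDecumulative_distortion (P := P) hψ hψ0 hψ1 hg
  have hH := isDecumulative_distortion (P := P) hψ hψ0 hψ1 (v := fun s => f s + g s)
    fun s => (abs_add_le _ _).trans (add_le_add (hf s) (hg s))
  simp only [distorted]
  rw [hF.integral_add_integral_eq, hG.integral_add_integral_eq, hH.integral_add_integral_eq,
    ← integral_add hF.integrableOn_upperQuantile hG.integrableOn_upperQuantile]
  exact setIntegral_congr_fun measurableSet_Ioo fun α hα =>
    upperQuantile_add_of_comonotonic (φ := fun A => ψ (P A).toReal) (monotone_distortion hψ)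
      (by simp [hψ0]) (by simp [hψ1]) hf hg hfg hα

end Distorted

lemma EReal.biInf_add_coe {ι : Type*} (s : Set ι) (u : ι → EReal) (k : ℝ) :
    (⨅ i ∈ s, (u i + (k : EReal))) = (⨅ i ∈ s, u i) + (k : EReal) := by
  apply le_antisymm
  · rw [← EReal.sub_le_iff_le_add (.inl (EReal.coe_ne_bot k)) (.inl (EReal.coe_ne_top k))]
    exact le_iInf₂ fun i hi => EReal.sub_le_of_le_add (iInf₂_le i hi)
  · exact le_iInf₂ fun i hi => add_le_add_left (iInf₂_le i hi) _

/-- The rank-dependent variational representation satisfies weak certainty dual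
independence: adding an unambiguous random variable `r` comonotonic with
`ṽ(w,·)` in every state of the world shifts each state-wise distorted value,
and hence the whole variational evaluation, by the dual-theory value `κ` of
`r`. -/
theorem distorted_variational_add_unambiguous_comonotonic
    {W S : Type*} [MeasurableSpace W] [MeasurableSpace S] [Nonempty W]
    (κ : ProbabilityTheory.Kernel W S) [ProbabilityTheory.IsMarkovKernel κ]
    (ψ : ℝ → ℝ) (hψmono : MonotoneOn ψ (Set.Icc 0 1))
    (hψmap : Set.MapsTo ψ (Set.Icc 0 1) (Set.Icc 0 1))
    (hψ0 : ψ 0 = 0) (hψ1 : ψ 1 = 1)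
    (vt : W × S → ℝ) (hvtm : Measurable vt) (hvtb : ∃ M, ∀ ω, |vt ω| ≤ M)
    (r : S → ℝ) (hrm : Measurable r) (hrb : ∃ M, ∀ s, |r s| ≤ M)
    (hcomo : ∀ (w : W) (s s' : S), (vt (w, s') - vt (w, s)) * (r s' - r s) ≥ 0)
    (hunamb : ∀ (w w' : W) (t : ℝ), κ w {s | t < r s} = κ w' {s | t < r s})
    (κval : ℝ) (hκval : ∀ w, distorted (κ w) ψ r = κval) :
    (∀ w : W, distorted (κ w) ψ (fun s => vt (w, s) + r s)
        = distorted (κ w) ψ (fun s => vt (w, s)) + κval) ∧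
    (∀ QQ : Set (Measure W), QQ.Nonempty → (∀ Q ∈ QQ, IsProbabilityMeasure Q) →
      ∀ c : Measure W → ENNReal,
      Measurable (fun w => distorted (κ w) ψ (fun s => vt (w, s))) →
      (⨅ Q ∈ QQ,
          (((∫ w, distorted (κ w) ψ (fun s => vt (w, s) + r s) ∂Q : ℝ) : EReal)
            + (c Q : EReal)))
        = (⨅ Q ∈ QQ,
            (((∫ w, distorted (κ w) ψ (fun s => vt (w, s)) ∂Q : ℝ) : EReal)
              + (c Q : EReal))) + (κval : EReal)) := by
  obtain ⟨M, hM⟩ := hvtb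
  obtain ⟨N, hN⟩ := hrb
  have hadd (w : W) : distorted (κ w) ψ (fun s => vt (w, s) + r s)
      = distorted (κ w) ψ (fun s => vt (w, s)) + κval := by
    rw [distorted_add_of_comonotonic hψmono hψ0 hψ1 (fun s => hM (w, s)) hN (hcomo w), hκval w]
  refine ⟨hadd, fun QQ _ hQQ c hmeas => ?_⟩
  rw [← EReal.biInf_add_coe]
  refine biInf_congr fun Q hQ => ?_
  have := hQQ Q hQ
  have hint : Integrable (fun w => distorted (κ w) ψ (fun s => vt (w, s))) Q :=
    Integrable.of_bound hmeas.aestronglyMeasurable M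
      (.of_forall fun w => abs_distorted_le hψmono hψ0 hψ1 fun s => hM (w, s))
  simp only [hadd]
  rw [integral_add hint (integrable_const κval)]
  simp only [integral_const, probReal_univ, one_smul, EReal.coe_add]
  exact add_right_comm _ _ _
end
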